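/- arXiv:1904.11188 — 2 statements merged into one kernel-verified Lean document; each statement's English description precedes it below -/
import Mathlib

section
/- Fix λ ≥ 0, a cost vector s ≥ 0 and a classical-quantum channel (ρ_x)_{x∈X}. Let p^t be a strictly positive probability distribution, p^{t+1} its Blahut–Arimoto update, and let p* be any maximizer of p ↦ f_λ(p, p) over Δ_n with supp(p*) ⊆ supp(p^t). Then 0 ≤ F(λ) − f_λ(p^{t+1}, p^t) ≤ D(p*‖p^t) − D(p*‖p^{t+1}), where F(λ) = f_λ(p*, p*). In particular the sequence D(p*‖p^t) is non-increasing along the Blahut–Arimoto iteration. -/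
open Matrix Finset Filter ComplexOrder

/-- Matrix logarithm on the support: for a Hermitian matrix, apply `Real.log`
to the eigenvalues (note `Real.log 0 = 0`, giving the logarithm on the support);
junk value `0` otherwise. -/
noncomputable def mlog {k : ℕ} (A : Matrix (Fin k) (Fin k) ℂ) : Matrix (Fin k) (Fin k) ℂ :=
  if h : A.IsHermitian then
    (h.eigenvectorUnitary : Matrix (Fin k) (Fin k) ℂ) *
      Matrix.diagonal (fun i => (Real.log (h.eigenvalues i) : ℂ)) *
      (star (h.eigenvectorUnitary : Matrix (Fin k) (Fin k) ℂ))
  else 0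

/-- A density matrix: positive semidefinite with unit trace. -/
def IsDensity {k : ℕ} (ρ : Matrix (Fin k) (Fin k) ℂ) : Prop :=
  ρ.PosSemidef ∧ ρ.trace = 1

/-- A probability distribution on `Fin k`. -/
def IsDist {k : ℕ} (p : Fin k → ℝ) : Prop :=
  (∀ x, 0 ≤ p x) ∧ ∑ x, p x = 1

/-- `supp ρ ⊆ supp σ`, expressed as `ker σ ⊆ ker ρ`. -/
def SuppLE {k : ℕ} (ρ σ : Matrix (Fin k) (Fin k) ℂ) : Prop :=
  ∀ v, σ.mulVec v = 0 → ρ.mulVec v = 0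

/-- Quantum relative entropy `D(ρ‖σ) = Tr[ρ(log ρ − log σ)]` (natural log). -/
noncomputable def qRelEnt {k : ℕ} (ρ σ : Matrix (Fin k) (Fin k) ℂ) : ℝ :=
  (Matrix.trace (ρ * (mlog ρ - mlog σ))).re

/-- Von Neumann entropy `H(ρ) = −Tr(ρ log ρ)` (natural log). -/
noncomputable def vN {k : ℕ} (ρ : Matrix (Fin k) (Fin k) ℂ) : ℝ :=
  -(Matrix.trace (ρ * mlog ρ)).re

/-- Classical relative entropy `D(p‖q)`. -/
noncomputable def cRelEnt {k : ℕ} (p q : Fin k → ℝ) : ℝ :=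
  ∑ x, p x * (Real.log (p x) - Real.log (q x))

/-- Holevo quantity `χ(p) = H(Σ_x p_x ρ_x) − Σ_x p_x H(ρ_x)`. -/
noncomputable def holevo {n m : ℕ} (ρ : Fin n → Matrix (Fin m) (Fin m) ℂ)
    (p : Fin n → ℝ) : ℝ :=
  vN (∑ x, (p x : ℂ) • ρ x) - ∑ x, p x * vN (ρ x)

/-- `f_λ(p, p') = Σ_x Tr{p_x ρ_x [log(p'_x ρ_x) − log(p_x ρ')]} − λ sᵀp`,
where `ρ' = Σ_x p'_x ρ_x`. -/
noncomputable def fBA {n m : ℕ} (ρ : Fin n → Matrix (Fin m) (Fin m) ℂ)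
    (s : Fin n → ℝ) (lam : ℝ) (p p' : Fin n → ℝ) : ℝ :=
  (∑ x, (Matrix.trace (((p x : ℂ) • ρ x) *
      (mlog ((p' x : ℂ) • ρ x) - mlog ((p x : ℂ) • ∑ y, (p' y : ℂ) • ρ y)))).re)
    - lam * ∑ x, s x * p x

/-- `r_x = exp(Tr{ρ_x[log(p_x ρ_x) − log ρ̄]} − λ s_x)` with `ρ̄ = Σ_y p_y ρ_y`. -/
noncomputable def rBA {n m : ℕ} (ρ : Fin n → Matrix (Fin m) (Fin m) ℂ)
    (s : Fin n → ℝ) (lam : ℝ) (p : Fin n → ℝ) (x : Fin n) : ℝ :=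
  Real.exp ((Matrix.trace (ρ x *
      (mlog ((p x : ℂ) • ρ x) - mlog (∑ y, (p y : ℂ) • ρ y)))).re - lam * s x)

/-- One Blahut–Arimoto update step. -/
noncomputable def baStep {n m : ℕ} (ρ : Fin n → Matrix (Fin m) (Fin m) ℂ)
    (s : Fin n → ℝ) (lam : ℝ) (p : Fin n → ℝ) (x : Fin n) : ℝ :=
  rBA ρ s lam p x / ∑ y, rBA ρ s lam p y

/-- The Blahut–Arimoto iterates starting from `p0`. -/
noncomputable def baSeq {n m : ℕ} (ρ : Fin n → Matrix (Fin m) (Fin m) ℂ)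
    (s : Fin n → ℝ) (lam : ℝ) (p0 : Fin n → ℝ) : ℕ → Fin n → ℝ
  | 0 => p0
  | t + 1 => baStep ρ s lam (baSeq ρ s lam p0 t)

section Hermitian

variable {k : ℕ} {A B : Matrix (Fin k) (Fin k) ℂ}

lemma mlog_eq_cfc (hA : A.IsHermitian) : mlog A = hA.cfc Real.log := by
  simp only [mlog, hA, dif_pos, Matrix.IsHermitian.cfc, Unitary.conjStarAlgAut_apply]
  rfl

lemma mlog_smul_eq_cfc (hA : A.IsHermitian) (c : ℝ) :
    mlog ((c : ℂ) • A) = hA.cfc (fun t => Real.log (c * t)) := by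
  have hc : ((c : ℂ) • A) = c • A := by
    ext i j
    simp
  have hcA : (c • A).IsHermitian := hc ▸ hA.smul (by simp [IsSelfAdjoint])
  rw [hc, mlog_eq_cfc hcA, ← hcA.cfc_eq, ← hA.cfc_eq,
    cfc_comp_const_mul c Real.log A
      ((Matrix.finite_real_spectrum.image _).continuousOn _) hA.isSelfAdjoint]

/-- Squared moduli of the inner products of the eigenvectors of two Hermitian matrices. -/
noncomputable def eigenOverlap (hA : A.IsHermitian) (hB : B.IsHermitian) (i j : Fin k) : ℝ :=
  Complex.normSq ((star (hA.eigenvectorUnitary : Matrix (Fin k) (Fin k) ℂ) *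
    (hB.eigenvectorUnitary : Matrix (Fin k) (Fin k) ℂ)) i j)

lemma eigenOverlap_nonneg (hA : A.IsHermitian) (hB : B.IsHermitian) (i j : Fin k) :
    0 ≤ eigenOverlap hA hB i j :=
  Complex.normSq_nonneg _

lemma trace_diagonal_mul_mul_conjTranspose (a : Fin k → ℂ) (M N : Matrix (Fin k) (Fin k) ℂ) :
    (Matrix.diagonal a * M * Nᴴ).trace = ∑ i, ∑ j, a i * M i j * star (N i j) := by
  rw [Matrix.mul_assoc]
  simp only [Matrix.trace, Matrix.diag, Matrix.diagonal_mul]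
  simp [Matrix.mul_apply, Finset.mul_sum, mul_assoc]

lemma trace_diagonal_mul_conjTranspose_mul (b : Fin k → ℂ) (M N : Matrix (Fin k) (Fin k) ℂ) :
    (Matrix.diagonal b * Mᴴ * N).trace = ∑ i, ∑ j, b j * star (M i j) * N i j := by
  rw [Finset.sum_comm, Matrix.mul_assoc]
  simp only [Matrix.trace, Matrix.diag, Matrix.diagonal_mul]
  simp [Matrix.mul_apply, Finset.mul_sum, mul_assoc]

lemma cfc_eq_mul_diagonal_mul (hA : A.IsHermitian) (f : ℝ → ℝ) :
    hA.cfc f = (hA.eigenvectorUnitary : Matrix (Fin k) (Fin k) ℂ) *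
      Matrix.diagonal (fun i => (f (hA.eigenvalues i) : ℂ)) *
      star (hA.eigenvectorUnitary : Matrix (Fin k) (Fin k) ℂ) := by
  simp only [Matrix.IsHermitian.cfc, Unitary.conjStarAlgAut_apply]
  rfl

lemma eq_mul_diagonal_mul (hA : A.IsHermitian) :
    A = (hA.eigenvectorUnitary : Matrix (Fin k) (Fin k) ℂ) *
      Matrix.diagonal (fun i => (hA.eigenvalues i : ℂ)) *
      star (hA.eigenvectorUnitary : Matrix (Fin k) (Fin k) ℂ) := by
  conv_lhs => rw [hA.spectral_theorem]
  simp only [Unitary.conjStarAlgAut_apply]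
  rfl

lemma cfc_id_eq (hA : A.IsHermitian) : hA.cfc id = A := by
  conv_rhs => rw [eq_mul_diagonal_mul hA]
  simp [cfc_eq_mul_diagonal_mul]

lemma cfc_const_one_eq (hA : A.IsHermitian) : hA.cfc (fun _ => 1) = 1 := by
  simp [cfc_eq_mul_diagonal_mul]

lemma re_trace_cfc_mul_cfc (hA : A.IsHermitian) (hB : B.IsHermitian) (f g : ℝ → ℝ) :
    (hA.cfc f * hB.cfc g).trace.re =
      ∑ i, ∑ j, eigenOverlap hA hB i j * (f (hA.eigenvalues i) * g (hB.eigenvalues j)) := by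
  set U := (hA.eigenvectorUnitary : Matrix (Fin k) (Fin k) ℂ) with hU
  set W := (hB.eigenvectorUnitary : Matrix (Fin k) (Fin k) ℂ) with hW
  set a : Fin k → ℂ := fun i => (f (hA.eigenvalues i) : ℂ)
  set b : Fin k → ℂ := fun i => (g (hB.eigenvalues i) : ℂ)
  have h : (hA.cfc f * hB.cfc g).trace =
      (Matrix.diagonal a * (star U * W * Matrix.diagonal b) * (star U * W)ᴴ).trace := by
    rw [cfc_eq_mul_diagonal_mul, cfc_eq_mul_diagonal_mul, ← hU, ← hW, Matrix.mul_assoc U,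
      Matrix.mul_assoc U, Matrix.trace_mul_comm U]
    simp only [Matrix.conjTranspose_mul, Matrix.star_eq_conjTranspose,
      Matrix.conjTranspose_conjTranspose, Matrix.mul_assoc]
    rfl
  rw [h, trace_diagonal_mul_mul_conjTranspose]
  simp only [Complex.re_sum]
  refine Finset.sum_congr rfl fun i _ => Finset.sum_congr rfl fun j _ => ?_
  rw [Matrix.mul_diagonal, eigenOverlap, ← hU, ← hW]
  simp only [a, b, Complex.normSq_apply, Complex.mul_re, Complex.mul_im, Complex.star_def,
    Complex.conj_re, Complex.conj_im, Complex.ofReal_re, Complex.ofReal_im]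
  ring

lemma re_trace_mul_cfc (hA : A.IsHermitian) (hB : B.IsHermitian) (g : ℝ → ℝ) :
    (A * hB.cfc g).trace.re =
      ∑ i, ∑ j, eigenOverlap hA hB i j * (hA.eigenvalues i * g (hB.eigenvalues j)) := by
  have h := re_trace_cfc_mul_cfc hA hB id g
  rwa [cfc_id_eq] at h

lemma re_trace_eq_sum_left (hA : A.IsHermitian) (hB : B.IsHermitian) :
    A.trace.re = ∑ i, ∑ j, eigenOverlap hA hB i j * hA.eigenvalues i := by
  simpa [cfc_const_one_eq] using re_trace_mul_cfc hA hB (fun _ => 1)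

lemma re_trace_eq_sum_right (hA : A.IsHermitian) (hB : B.IsHermitian) :
    B.trace.re = ∑ i, ∑ j, eigenOverlap hA hB i j * hB.eigenvalues j := by
  simpa [cfc_const_one_eq, cfc_id_eq] using re_trace_cfc_mul_cfc hA hB (fun _ => 1) id

lemma re_trace_mul_mlog_self (hA : A.IsHermitian) (hB : B.IsHermitian) :
    (A * mlog A).trace.re =
      ∑ i, ∑ j, eigenOverlap hA hB i j * (hA.eigenvalues i * Real.log (hA.eigenvalues i)) := by
  have hmul : A * mlog A = hA.cfc (fun t => t * Real.log t) := by
    rw [mlog_eq_cfc hA, ← hA.cfc_eq, ← hA.cfc_eq,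
      cfc_mul (fun t => t) Real.log A (Matrix.finite_real_spectrum.continuousOn _)
        (Matrix.finite_real_spectrum.continuousOn _), cfc_id' ℝ A hA.isSelfAdjoint]
  have h := re_trace_cfc_mul_cfc hA hB (fun t => t * Real.log t) (fun _ => 1)
  rw [cfc_const_one_eq, Matrix.mul_one, ← hmul] at h
  simpa using h

lemma SuppLE.eigenOverlap_mul_eq_zero (hAB : SuppLE A B) (hA : A.IsHermitian)
    (hB : B.IsHermitian) (i j : Fin k) (hj : hB.eigenvalues j = 0) :
    eigenOverlap hA hB i j * hA.eigenvalues i = 0 := by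
  set U := (hA.eigenvectorUnitary : Matrix (Fin k) (Fin k) ℂ) with hU
  set W := (hB.eigenvectorUnitary : Matrix (Fin k) (Fin k) ℂ) with hW
  have hUA : star U * A = Matrix.diagonal (fun i => (hA.eigenvalues i : ℂ)) * star U := by
    conv_lhs => rw [eq_mul_diagonal_mul hA, ← hU, ← Matrix.mul_assoc, ← Matrix.mul_assoc]
    simp [hU]
  have hBW : B * W = W * Matrix.diagonal (fun i => (hB.eigenvalues i : ℂ)) := by
    conv_lhs => rw [eq_mul_diagonal_mul hB, ← hW, Matrix.mul_assoc]
    simp [hW]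
  have hker : A.mulVec (W.col j) = 0 := by
    apply hAB
    ext l
    have := congrFun (congrFun hBW l) j
    rw [Matrix.mul_diagonal, hj] at this
    simpa [Matrix.mul_apply, Matrix.mulVec, dotProduct] using this
  have hAW : ∀ l, (A * W) l j = 0 := fun l => by
    simpa [Matrix.mul_apply, Matrix.mulVec, dotProduct] using congrFun hker l
  have h0 : (hA.eigenvalues i : ℂ) * (star U * W) i j = 0 := by
    have h1 : (star U * A * W) i j =
        (Matrix.diagonal (fun i => (hA.eigenvalues i : ℂ)) * star U * W) i j := by rw [hUA]
    rw [Matrix.mul_assoc, Matrix.mul_assoc] at h1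
    rw [Matrix.diagonal_mul, Matrix.mul_apply] at h1
    rw [← h1]
    simp [hAW]
  rcases mul_eq_zero.mp h0 with h | h
  · rw [Complex.ofReal_eq_zero.mp h, mul_zero]
  · rw [eigenOverlap, ← hU, ← hW, h, map_zero, zero_mul]

lemma re_trace_mul_mlog_smul (hA : A.IsHermitian) (hB : B.IsHermitian) (hAB : SuppLE A B)
    {c : ℝ} (hc : 0 < c) :
    (A * mlog ((c : ℂ) • B)).trace.re =
      Real.log c * A.trace.re + (A * mlog B).trace.re := by
  rw [mlog_smul_eq_cfc hB, mlog_eq_cfc hB, re_trace_mul_cfc hA hB, re_trace_mul_cfc hA hB,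
    re_trace_eq_sum_left hA hB]
  simp only [Finset.mul_sum, ← Finset.sum_add_distrib]
  refine Finset.sum_congr rfl fun i _ => Finset.sum_congr rfl fun j _ => ?_
  by_cases hj : hB.eigenvalues j = 0
  · have h := hAB.eigenOverlap_mul_eq_zero hA hB i j hj
    simp only [← mul_assoc, h]
    ring
  · rw [Real.log_mul hc.ne' hj]
    ring

lemma qRelEnt_eq_sum (hA : A.IsHermitian) (hB : B.IsHermitian) :
    qRelEnt A B = ∑ i, ∑ j, eigenOverlap hA hB i j *
      (hA.eigenvalues i * (Real.log (hA.eigenvalues i) - Real.log (hB.eigenvalues j))) := by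
  rw [qRelEnt, Matrix.mul_sub, Matrix.trace_sub, Complex.sub_re, re_trace_mul_mlog_self hA hB,
    mlog_eq_cfc hB, re_trace_mul_cfc hA hB]
  simp only [mul_sub, Finset.sum_sub_distrib]

/-- **Klein's inequality**. -/
lemma qRelEnt_nonneg (hA : A.PosSemidef) (hB : B.PosSemidef) (hAB : SuppLE A B)
    (htr : A.trace = B.trace) : 0 ≤ qRelEnt A B := by
  have h0 : ∑ i, ∑ j, eigenOverlap hA.1 hB.1 i j * (hA.1.eigenvalues i - hB.1.eigenvalues j)
      = 0 := by
    simp only [mul_sub, Finset.sum_sub_distrib]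
    rw [← re_trace_eq_sum_left, ← re_trace_eq_sum_right, htr, sub_self]
  rw [qRelEnt_eq_sum hA.1 hB.1, ← h0]
  refine Finset.sum_le_sum fun i _ => Finset.sum_le_sum fun j _ => ?_
  have hw := eigenOverlap_nonneg hA.1 hB.1 i j
  have ha : 0 ≤ hA.1.eigenvalues i := hA.eigenvalues_nonneg i
  have hb : 0 ≤ hB.1.eigenvalues j := hB.eigenvalues_nonneg j
  have hz := hAB.eigenOverlap_mul_eq_zero hA.1 hB.1 i j
  generalize hA.1.eigenvalues i = a at *
  generalize hB.1.eigenvalues j = b at *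
  rcases hb.eq_or_lt with rfl | hb
  · rw [← mul_assoc, hz rfl]
    simp [hz rfl]
  · refine mul_le_mul_of_nonneg_left ?_ hw
    rcases ha.eq_or_lt with rfl | ha
    · simpa using hb.le
    · have h := Real.log_le_sub_one_of_pos (div_pos hb ha)
      rw [Real.log_div hb.ne' ha.ne'] at h
      have h' := mul_le_mul_of_nonneg_left h ha.le
      have : a * (b / a - 1) = b - a := by field_simp
      linarith

end Hermitian

section Monotonicity

lemma hasDerivAt_mul_log_segment {a b u : ℝ} (ha : 0 ≤ a) (hb : 0 ≤ b) (hu : u ∈ Set.Ioo 0 1) :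
    HasDerivAt (fun u => a * Real.log (b + u * (a - b)) - (a - b) * u)
      ((1 - u) * ((a - b) ^ 2 / (b + u * (a - b)))) u := by
  obtain ⟨hu0, hu1⟩ := hu
  rcases ha.eq_or_lt with rfl | ha
  · rcases hb.eq_or_lt with rfl | hb
    · simpa using hasDerivAt_const u (0 : ℝ)
    · have h : (1 - u) * ((0 - b) ^ 2 / (b + u * (0 - b))) = b := by
        have : b + u * (0 - b) ≠ 0 := by nlinarith [mul_pos hb (sub_pos.mpr hu1)]
        field_simp
        ring
      rw [h]
      simpa using (hasDerivAt_id u).const_mul b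
  · have hpos : b + u * (a - b) ≠ 0 := by
      nlinarith [mul_pos hu0 ha, mul_nonneg (sub_pos.mpr hu1).le hb]
    have h1 : HasDerivAt (fun u => b + u * (a - b)) (a - b) u := by
      simpa using ((hasDerivAt_id u).mul_const (a - b)).const_add b
    have h2 := ((h1.log hpos).const_mul a).sub ((hasDerivAt_id u).const_mul (a - b))
    refine h2.congr_deriv ?_
    rw [← mul_div_assoc, ← mul_div_assoc, sub_eq_iff_eq_add, div_eq_iff hpos, add_mul,
      div_mul_cancel₀ _ hpos]
    ring

lemma continuousOn_mul_log_segment {a b : ℝ} (ha : 0 ≤ a) (hb : 0 ≤ b) (hab : b = 0 → a = 0) :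
    ContinuousOn (fun u => a * Real.log (b + u * (a - b)) - (a - b) * u) (Set.Icc 0 1) := by
  rcases ha.eq_or_lt with rfl | ha
  · simp only [zero_mul]
    fun_prop
  · have hb' : 0 < b := hb.lt_of_ne' fun h => ha.ne' (hab h)
    have hne : ∀ u ∈ Set.Icc (0 : ℝ) 1, b + u * (a - b) ≠ 0 := by
      rintro u ⟨hu0, hu1⟩
      rcases hu0.eq_or_lt with rfl | hu0
      · simpa using hb'.ne'
      · nlinarith [mul_pos hu0 ha, mul_nonneg (sub_nonneg.mpr hu1) hb]
    fun_prop (disch := assumption)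

variable {n k : ℕ}

lemma re_trace_mul_conjTranspose {ρ : Matrix (Fin k) (Fin k) ℂ} (hρ : ρ.IsHermitian)
    (Z : Matrix (Fin k) (Fin k) ℂ) : (ρ * Zᴴ).trace.re = (ρ * Z).trace.re := by
  have h : ρ * Zᴴ = (Z * ρ)ᴴ := by rw [Matrix.conjTranspose_mul, hρ.eq]
  rw [h, Matrix.trace_conjTranspose, Matrix.trace_mul_comm]
  simp

lemma sq_re_trace_mul_le {ρ : Matrix (Fin k) (Fin k) ℂ} (hρ : IsDensity ρ)
    (Z : Matrix (Fin k) (Fin k) ℂ) :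
    (ρ * Z).trace.re ^ 2 ≤ (ρ * Z * Zᴴ).trace.re := by
  set c : ℝ := (ρ * Z).trace.re with hc
  have hnn := (hρ.1.conjTranspose_mul_mul_same (Z - (c : ℂ) • 1)).trace_nonneg
  rw [Matrix.mul_assoc, Matrix.trace_mul_comm] at hnn
  have hre := (Complex.le_def.mp hnn).1
  have hexp : ρ * (Z - (c : ℂ) • 1) * (Z - (c : ℂ) • 1)ᴴ =
      ρ * Z * Zᴴ - (c : ℂ) • (ρ * Z) - (c : ℂ) • (ρ * Zᴴ) + ((c : ℂ) * c) • ρ := by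
    simp only [Matrix.conjTranspose_sub, Matrix.conjTranspose_smul, Matrix.conjTranspose_one,
      Complex.star_def, Complex.conj_ofReal, Matrix.mul_sub, Matrix.sub_mul, Matrix.mul_smul,
      Matrix.smul_mul, Matrix.mul_one, smul_smul, smul_sub]
    abel
  rw [hexp, Matrix.trace_add, Matrix.trace_sub, Matrix.trace_sub, Matrix.trace_smul,
    Matrix.trace_smul, Matrix.trace_smul, hρ.2] at hre
  simp only [Complex.add_re, Complex.sub_re, smul_eq_mul, Complex.re_ofReal_mul,
    re_trace_mul_conjTranspose hρ.1.1, ← hc, mul_one, Complex.ofReal_re, Complex.zero_re] at hre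
  linarith

/-- Every real kernel `y` on pairs of eigenvectors is realised by a matrix `Y` for which the
linear and quadratic trace functionals are the corresponding sums over eigenvalue pairs. -/
lemma exists_matrix_of_kernel {A B : Matrix (Fin k) (Fin k) ℂ} (hA : A.IsHermitian)
    (hB : B.IsHermitian) (y : Fin k → Fin k → ℝ) :
    ∃ Y : Matrix (Fin k) (Fin k) ℂ,
      (A * Y).trace.re = ∑ i, ∑ j, eigenOverlap hA hB i j * (hA.eigenvalues i * y i j) ∧
      (B * Y).trace.re = ∑ i, ∑ j, eigenOverlap hA hB i j * (hB.eigenvalues j * y i j) ∧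
      (A * Y * Yᴴ).trace.re =
        ∑ i, ∑ j, eigenOverlap hA hB i j * (hA.eigenvalues i * y i j ^ 2) ∧
      (B * Yᴴ * Y).trace.re =
        ∑ i, ∑ j, eigenOverlap hA hB i j * (hB.eigenvalues j * y i j ^ 2) := by
  set U := (hA.eigenvectorUnitary : Matrix (Fin k) (Fin k) ℂ) with hU
  set W := (hB.eigenvectorUnitary : Matrix (Fin k) (Fin k) ℂ) with hW
  set a : Fin k → ℂ := fun i => (hA.eigenvalues i : ℂ)
  set b : Fin k → ℂ := fun i => (hB.eigenvalues i : ℂ)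
  have hUU : ∀ M : Matrix (Fin k) (Fin k) ℂ, Uᴴ * (U * M) = M := fun M => by
    rw [← Matrix.mul_assoc, ← Matrix.star_eq_conjTranspose,
      Unitary.star_mul_self_of_mem hA.eigenvectorUnitary.2, Matrix.one_mul]
  have hWW : ∀ M : Matrix (Fin k) (Fin k) ℂ, Wᴴ * (W * M) = M := fun M => by
    rw [← Matrix.mul_assoc, ← Matrix.star_eq_conjTranspose,
      Unitary.star_mul_self_of_mem hB.eigenvectorUnitary.2, Matrix.one_mul]
  have hAeq : A = U * Matrix.diagonal a * Uᴴ := eq_mul_diagonal_mul hA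
  have hBeq : B = W * Matrix.diagonal b * Wᴴ := eq_mul_diagonal_mul hB
  set V : Matrix (Fin k) (Fin k) ℂ := Uᴴ * W with hV
  set G : Matrix (Fin k) (Fin k) ℂ := Matrix.of fun i j => V i j * (y i j : ℂ) with hG
  have hw : ∀ i j, eigenOverlap hA hB i j = Complex.normSq (V i j) := fun i j => rfl
  have h1 : (A * (U * G * Wᴴ)).trace = (Matrix.diagonal a * G * Vᴴ).trace := by
    rw [hAeq]
    simp only [Matrix.mul_assoc, hUU]
    rw [Matrix.trace_mul_comm U]
    simp only [hV, Matrix.conjTranspose_mul, Matrix.conjTranspose_conjTranspose, Matrix.mul_assoc]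
  have h2 : (B * (U * G * Wᴴ)).trace = (Matrix.diagonal b * Vᴴ * G).trace := by
    rw [hBeq]
    simp only [Matrix.mul_assoc]
    rw [Matrix.trace_mul_comm W]
    have hz : Wᴴ * W = 1 := by simpa using hWW 1
    simp only [hV, Matrix.conjTranspose_mul, Matrix.conjTranspose_conjTranspose, Matrix.mul_assoc,
      hz, Matrix.mul_one]
  have h3 : (A * (U * G * Wᴴ) * (U * G * Wᴴ)ᴴ).trace = (Matrix.diagonal a * G * Gᴴ).trace := by
    rw [hAeq]
    simp only [Matrix.mul_assoc, hUU, hWW, Matrix.conjTranspose_mul,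
      Matrix.conjTranspose_conjTranspose]
    rw [Matrix.trace_mul_comm U]
    have hz : Uᴴ * U = 1 := by simpa using hUU 1
    simp only [Matrix.mul_assoc, hz, Matrix.mul_one]
  have h4 : (B * (U * G * Wᴴ)ᴴ * (U * G * Wᴴ)).trace = (Matrix.diagonal b * Gᴴ * G).trace := by
    rw [hBeq]
    simp only [Matrix.mul_assoc, hUU, hWW, Matrix.conjTranspose_mul,
      Matrix.conjTranspose_conjTranspose]
    rw [Matrix.trace_mul_comm W]
    have hz : Wᴴ * W = 1 := by simpa using hWW 1
    simp only [Matrix.mul_assoc, hz, Matrix.mul_one]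
  refine ⟨U * G * Wᴴ, ?_, ?_, ?_, ?_⟩
  · rw [h1, trace_diagonal_mul_mul_conjTranspose]
    simp only [Complex.re_sum]
    refine Finset.sum_congr rfl fun i _ => Finset.sum_congr rfl fun j _ => ?_
    simp only [hw, hG, a, Matrix.of_apply, Complex.normSq_apply, Complex.mul_re, Complex.mul_im,
      Complex.star_def, Complex.conj_re, Complex.conj_im, Complex.ofReal_re, Complex.ofReal_im]
    ring
  · rw [h2, trace_diagonal_mul_conjTranspose_mul]
    simp only [Complex.re_sum]
    refine Finset.sum_congr rfl fun i _ => Finset.sum_congr rfl fun j _ => ?_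
    simp only [hw, hG, b, Matrix.of_apply, Complex.normSq_apply, Complex.mul_re, Complex.mul_im,
      Complex.star_def, Complex.conj_re, Complex.conj_im, Complex.ofReal_re, Complex.ofReal_im]
    ring
  · rw [h3, trace_diagonal_mul_mul_conjTranspose]
    simp only [Complex.re_sum]
    refine Finset.sum_congr rfl fun i _ => Finset.sum_congr rfl fun j _ => ?_
    simp only [hw, hG, a, Matrix.of_apply, Complex.normSq_apply, Complex.mul_re, Complex.mul_im,
      Complex.star_def, Complex.conj_re, Complex.conj_im, Complex.ofReal_re, Complex.ofReal_im]
    ring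
  · rw [h4, trace_diagonal_mul_conjTranspose_mul]
    simp only [Complex.re_sum]
    refine Finset.sum_congr rfl fun i _ => Finset.sum_congr rfl fun j _ => ?_
    simp only [hw, hG, b, Matrix.of_apply, Complex.normSq_apply, Complex.mul_re, Complex.mul_im,
      Complex.star_def, Complex.conj_re, Complex.conj_im, Complex.ofReal_re, Complex.ofReal_im]
    ring

variable {ρ : Fin n → Matrix (Fin k) (Fin k) ℂ} {p q : Fin n → ℝ}

lemma re_trace_sum_smul_mul (ρ : Fin n → Matrix (Fin k) (Fin k) ℂ) (q : Fin n → ℝ)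
    (Z : Matrix (Fin k) (Fin k) ℂ) :
    ((∑ x, (q x : ℂ) • ρ x) * Z).trace.re = ∑ x, q x * (ρ x * Z).trace.re := by
  simp [Finset.sum_mul, Matrix.trace_sum]

lemma posSemidef_sum_smul (hρ : ∀ x, IsDensity (ρ x)) (hq : ∀ x, 0 ≤ q x) :
    (∑ x, (q x : ℂ) • ρ x).PosSemidef :=
  Matrix.posSemidef_sum _ fun x _ => (hρ x).1.smul (by exact_mod_cast hq x)

lemma trace_sum_smul (hρ : ∀ x, IsDensity (ρ x)) (hq : ∑ x, q x = 1) :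
    (∑ x, (q x : ℂ) • ρ x).trace = 1 := by
  simp only [Matrix.trace_sum, Matrix.trace_smul, (hρ _).2, smul_eq_mul, mul_one]
  exact_mod_cast hq

lemma suppLE_sum_smul (hρ : ∀ x, IsDensity (ρ x)) (hp : ∀ x, 0 ≤ p x) {x : Fin n}
    (hx : p x ≠ 0) : SuppLE (ρ x) (∑ y, (p y : ℂ) • ρ y) := by
  intro v hv
  have hnn : ∀ y, ((p y : ℂ) • ρ y).PosSemidef := fun y =>
    (hρ y).1.smul (by exact_mod_cast hp y)
  have hsum : ∑ y, star v ⬝ᵥ (((p y : ℂ) • ρ y) *ᵥ v) = 0 := by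
    rw [← dotProduct_sum, ← Matrix.sum_mulVec, hv, dotProduct_zero]
  have h := (Finset.sum_eq_zero_iff_of_nonneg fun y _ =>
    (hnn y).dotProduct_mulVec_nonneg v).mp hsum x (Finset.mem_univ x)
  have h' := ((hnn x).dotProduct_mulVec_zero_iff v).mp h
  rw [Matrix.smul_mulVec] at h'
  exact (smul_eq_zero.mp h').resolve_left (by exact_mod_cast hx)

lemma suppLE_sum_smul_sum_smul (hρ : ∀ x, IsDensity (ρ x)) (hp : ∀ x, 0 ≤ p x)
    (hqp : ∀ x, q x ≠ 0 → p x ≠ 0) :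
    SuppLE (∑ x, (q x : ℂ) • ρ x) (∑ x, (p x : ℂ) • ρ x) := by
  intro v hv
  rw [Matrix.sum_mulVec]
  refine Finset.sum_eq_zero fun x _ => ?_
  by_cases hx : q x = 0
  · simp [hx]
  · rw [Matrix.smul_mulVec, suppLE_sum_smul hρ hp (hqp x hx) v hv, smul_zero]

/-- A symmetrised `χ²`-divergence contracts under the classical-quantum map
`q ↦ ∑ x, q x • ρ x`. -/
lemma sum_eigenOverlap_sq_sub_div_le (hρ : ∀ x, IsDensity (ρ x)) (hq : ∀ x, 0 ≤ q x)
    (hp : ∀ x, 0 ≤ p x) (hA : (∑ x, (q x : ℂ) • ρ x).PosSemidef)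
    (hB : (∑ x, (p x : ℂ) • ρ x).PosSemidef) {u : ℝ} (hu : u ∈ Set.Ioo 0 1) :
    ∑ i, ∑ j, eigenOverlap hA.1 hB.1 i j *
        ((hA.1.eigenvalues i - hB.1.eigenvalues j) ^ 2 /
          (hB.1.eigenvalues j + u * (hA.1.eigenvalues i - hB.1.eigenvalues j))) ≤
      ∑ x, (q x - p x) ^ 2 / (p x + u * (q x - p x)) := by
  obtain ⟨hu0, hu1⟩ := hu
  obtain ⟨Y, hAY, hBY, hAYY, hBYY⟩ := exists_matrix_of_kernel hA.1 hB.1 fun i j =>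
    (hA.1.eigenvalues i - hB.1.eigenvalues j) /
      (hB.1.eigenvalues j + u * (hA.1.eigenvalues i - hB.1.eigenvalues j))
  have hscalar : ∀ d c : ℝ, 2 * (d * (d / c)) - c * (d / c) ^ 2 = d ^ 2 / c := fun d c => by
    rcases eq_or_ne c 0 with rfl | hc
    · simp
    · field_simp
      ring
  trans 2 * ((∑ x, (q x : ℂ) • ρ x) * Y).trace.re - 2 * ((∑ x, (p x : ℂ) • ρ x) * Y).trace.re
      - u * ((∑ x, (q x : ℂ) • ρ x) * Y * Yᴴ).trace.re
      - (1 - u) * ((∑ x, (p x : ℂ) • ρ x) * Yᴴ * Y).trace.re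
  · rw [hAY, hBY, hAYY, hBYY]
    simp only [Finset.mul_sum, ← Finset.sum_sub_distrib]
    refine Finset.sum_le_sum fun i _ => Finset.sum_le_sum fun j _ => le_of_eq ?_
    rw [← hscalar]
    ring
  · simp only [Matrix.mul_assoc, re_trace_sum_smul_mul]
    simp only [Finset.mul_sum, ← Finset.sum_sub_distrib]
    refine Finset.sum_le_sum fun x _ => ?_
    have h1 := sq_re_trace_mul_le (hρ x) Y
    have h2 := sq_re_trace_mul_le (hρ x) Yᴴ
    rw [re_trace_mul_conjTranspose (hρ x).1.1, Matrix.conjTranspose_conjTranspose] at h2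
    rw [Matrix.mul_assoc] at h1 h2
    have h1' := mul_le_mul_of_nonneg_left h1 (mul_nonneg hu0.le (hq x))
    have h2' := mul_le_mul_of_nonneg_left h2 (mul_nonneg (sub_pos.mpr hu1).le (hp x))
    set r := (ρ x * Y).trace.re
    have h3 : 2 * (q x - p x) * r - (p x + u * (q x - p x)) * r ^ 2 ≤
        (q x - p x) ^ 2 / (p x + u * (q x - p x)) := by
      have hc : 0 ≤ p x + u * (q x - p x) := by
        nlinarith [mul_nonneg hu0.le (hq x), mul_nonneg (sub_pos.mpr hu1).le (hp x)]
      rcases hc.eq_or_lt with hc | hc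
      · have hqx : q x = 0 := by
          nlinarith [mul_nonneg hu0.le (hq x), mul_nonneg (sub_pos.mpr hu1).le (hp x), hq x]
        have hpx : p x = 0 := by
          nlinarith [mul_nonneg hu0.le (hq x), mul_nonneg (sub_pos.mpr hu1).le (hp x), hp x]
        simp [hqx, hpx]
      · rw [le_div_iff₀ hc]
        nlinarith [sq_nonneg ((q x - p x) - (p x + u * (q x - p x)) * r)]
    linarith

/-- Monotonicity of relative entropy under a classical-quantum map. -/
lemma qRelEnt_sum_smul_le_cRelEnt (hρ : ∀ x, IsDensity (ρ x)) (hq : IsDist q) (hp : IsDist p)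
    (hqp : ∀ x, p x = 0 → q x = 0) :
    qRelEnt (∑ x, (q x : ℂ) • ρ x) (∑ x, (p x : ℂ) • ρ x) ≤ cRelEnt q p := by
  have hA := posSemidef_sum_smul hρ hq.1
  have hB := posSemidef_sum_smul hρ hp.1
  have hAB := suppLE_sum_smul_sum_smul hρ hp.1 (fun x => mt (hqp x))
  set a := hA.1.eigenvalues with ha
  set b := hB.1.eigenvalues with hb
  set w := eigenOverlap hA.1 hB.1 with hw
  have ha0 : ∀ i, 0 ≤ a i := hA.eigenvalues_nonneg
  have hb0 : ∀ j, 0 ≤ b j := hB.eigenvalues_nonneg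
  let g : ℝ → ℝ → ℝ → ℝ := fun a b u => a * Real.log (b + u * (a - b)) - (a - b) * u
  let h : ℝ → ℝ := fun u => ∑ x, g (q x) (p x) u - ∑ i, ∑ j, w i j * g (a i) (b j) u
  have hderiv : ∀ u ∈ Set.Ioo (0 : ℝ) 1, HasDerivAt h
      (∑ x, (1 - u) * ((q x - p x) ^ 2 / (p x + u * (q x - p x))) -
        ∑ i, ∑ j, w i j * ((1 - u) * ((a i - b j) ^ 2 / (b j + u * (a i - b j))))) u := by
    intro u hu
    refine .sub (.fun_sum fun x _ => hasDerivAt_mul_log_segment (hq.1 x) (hp.1 x) hu)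
      (.fun_sum fun i _ => .fun_sum fun j _ => .const_mul _ ?_)
    exact hasDerivAt_mul_log_segment (ha0 i) (hb0 j) hu
  have hcont : ContinuousOn h (Set.Icc 0 1) := by
    refine .sub (continuousOn_finsetSum _ fun x _ =>
      continuousOn_mul_log_segment (hq.1 x) (hp.1 x) (hqp x))
      (continuousOn_finsetSum _ fun i _ => continuousOn_finsetSum _ fun j _ => ?_)
    by_cases hwij : w i j = 0
    · simp only [hwij, zero_mul]
      exact continuousOn_const
    · refine continuousOn_const.mul (continuousOn_mul_log_segment (ha0 i) (hb0 j) fun hbj => ?_)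
      exact (mul_eq_zero.mp (hAB.eigenOverlap_mul_eq_zero hA.1 hB.1 i j hbj)).resolve_left hwij
  have hmono : MonotoneOn h (Set.Icc 0 1) := by
    refine monotoneOn_of_deriv_nonneg (convex_Icc 0 1) hcont ?_ ?_
    · rw [interior_Icc]
      exact fun u hu => (hderiv u hu).differentiableAt.differentiableWithinAt
    · rw [interior_Icc]
      intro u hu
      rw [(hderiv u hu).deriv]
      have hle := mul_le_mul_of_nonneg_left
        (sum_eigenOverlap_sq_sub_div_le hρ hq.1 hp.1 hA hB hu) (sub_pos.mpr hu.2).le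
      simp only [Finset.mul_sum] at hle
      rw [sub_nonneg]
      refine le_trans (le_of_eq ?_) hle
      refine Finset.sum_congr rfl fun i _ => Finset.sum_congr rfl fun j _ => ?_
      exact mul_left_comm _ _ _
  have h01 := hmono (Set.left_mem_Icc.mpr zero_le_one) (Set.right_mem_Icc.mpr zero_le_one)
    zero_le_one
  have hpq0 : ∑ x, (q x - p x) = 0 := by
    rw [Finset.sum_sub_distrib, hq.2, hp.2, sub_self]
  have hw0 : ∑ i, ∑ j, w i j * (a i - b j) = 0 := by
    simp only [mul_sub, Finset.sum_sub_distrib]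
    rw [hw, ha, hb, ← re_trace_eq_sum_left, ← re_trace_eq_sum_right, trace_sum_smul hρ hq.2,
      trace_sum_smul hρ hp.2, sub_self]
  rw [qRelEnt_eq_sum hA.1 hB.1, cRelEnt, ← hw, ← ha, ← hb]
  simp only [h, g, one_mul, add_sub_cancel, zero_mul, add_zero, mul_one, mul_zero, sub_zero,
    mul_sub, Finset.sum_sub_distrib, Finset.sum_const_zero] at h01 hpq0 hw0 ⊢
  linarith

end Monotonicity

section BlahutArimoto

variable {n m : ℕ} {ρ : Fin n → Matrix (Fin m) (Fin m) ℂ} {s : Fin n → ℝ} {lam : ℝ}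
  {p q : Fin n → ℝ}

lemma fBA_eq_sum (hρ : ∀ x, IsDensity (ρ x)) (hp : ∀ x, 0 ≤ p x) (hq : ∀ x, 0 ≤ q x)
    (hpq : ∀ x, p x ≠ 0 → q x ≠ 0) :
    fBA ρ s lam p q =
      ∑ x, p x * (Real.log (q x) - Real.log (p x) + qRelEnt (ρ x) (∑ y, (q y : ℂ) • ρ y)
        - lam * s x) := by
  rw [fBA, Finset.mul_sum, ← Finset.sum_sub_distrib]
  refine Finset.sum_congr rfl fun x _ => ?_
  by_cases hx : p x = 0
  · simp [hx]
  · have hpx := (hp x).lt_of_ne' hx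
    have hqx := (hq x).lt_of_ne' (hpq x hx)
    rw [Matrix.smul_mul, Matrix.trace_smul, smul_eq_mul, Complex.re_ofReal_mul, Matrix.mul_sub,
      Matrix.trace_sub, Complex.sub_re,
      re_trace_mul_mlog_smul (hρ x).1.1 (hρ x).1.1 (fun _ => id) hqx,
      re_trace_mul_mlog_smul (hρ x).1.1 (posSemidef_sum_smul hρ hq).1
        (suppLE_sum_smul hρ hq (hpq x hx)) hpx, (hρ x).2, qRelEnt, Matrix.mul_sub,
      Matrix.trace_sub, Complex.sub_re]
    simp only [Complex.one_re]
    ring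

lemma log_rBA (hρ : ∀ x, IsDensity (ρ x)) {x : Fin n} (hx : 0 < p x) :
    Real.log (rBA ρ s lam p x) =
      Real.log (p x) + qRelEnt (ρ x) (∑ y, (p y : ℂ) • ρ y) - lam * s x := by
  rw [rBA, Real.log_exp, Matrix.mul_sub, Matrix.trace_sub, Complex.sub_re,
    re_trace_mul_mlog_smul (hρ x).1.1 (hρ x).1.1 (fun _ => id) hx, (hρ x).2, qRelEnt,
    Matrix.mul_sub, Matrix.trace_sub, Complex.sub_re]
  simp only [Complex.one_re]
  ring

lemma rBA_pos (x : Fin n) : 0 < rBA ρ s lam p x := Real.exp_pos _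

lemma sum_rBA_pos (hp : IsDist p) : 0 < ∑ y, rBA ρ s lam p y := by
  have hne : (Finset.univ : Finset (Fin n)).Nonempty := by
    rw [Finset.nonempty_iff_ne_empty]
    intro h
    simpa [h] using hp.2
  exact Finset.sum_pos (fun y _ => rBA_pos y) hne

lemma baStep_pos (hp : IsDist p) (x : Fin n) : 0 < baStep ρ s lam p x :=
  div_pos (rBA_pos x) (sum_rBA_pos hp)

lemma isDist_baStep (hp : IsDist p) : IsDist (baStep ρ s lam p) := by
  refine ⟨fun x => (baStep_pos hp x).le, ?_⟩
  simp only [baStep, ← Finset.sum_div]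
  exact div_self (sum_rBA_pos hp).ne'

lemma log_baStep (hρ : ∀ x, IsDensity (ρ x)) (hp : IsDist p) {x : Fin n} (hx : 0 < p x) :
    Real.log (baStep ρ s lam p x) =
      Real.log (p x) + qRelEnt (ρ x) (∑ y, (p y : ℂ) • ρ y) - lam * s x
        - Real.log (∑ y, rBA ρ s lam p y) := by
  rw [baStep, Real.log_div (rBA_pos x).ne' (sum_rBA_pos hp).ne', log_rBA hρ hx]

lemma fBA_baStep (hρ : ∀ x, IsDensity (ρ x)) (hp : IsDist p) (hpos : ∀ x, 0 < p x) :
    fBA ρ s lam (baStep ρ s lam p) p = Real.log (∑ y, rBA ρ s lam p y) := by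
  rw [fBA_eq_sum hρ (isDist_baStep hp).1 hp.1 fun x _ => (hpos x).ne']
  have h : ∀ x, Real.log (p x) - Real.log (baStep ρ s lam p x)
      + qRelEnt (ρ x) (∑ y, (p y : ℂ) • ρ y) - lam * s x =
      Real.log (∑ y, rBA ρ s lam p y) := fun x => by
    rw [log_baStep hρ hp (hpos x)]
    ring
  simp only [h, ← Finset.sum_mul, (isDist_baStep hp).2, one_mul]

lemma qRelEnt_sum_smul (ρ : Fin n → Matrix (Fin m) (Fin m) ℂ) (p q : Fin n → ℝ) :
    qRelEnt (∑ x, (q x : ℂ) • ρ x) (∑ x, (p x : ℂ) • ρ x) =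
      ∑ x, q x * qRelEnt (ρ x) (∑ y, (p y : ℂ) • ρ y) -
        ∑ x, q x * qRelEnt (ρ x) (∑ y, (q y : ℂ) • ρ y) := by
  rw [qRelEnt, re_trace_sum_smul_mul, ← Finset.sum_sub_distrib]
  refine Finset.sum_congr rfl fun x _ => ?_
  simp only [qRelEnt, Matrix.mul_sub, Matrix.trace_sub, Complex.sub_re]
  ring

/-- For fixed `q`, the functional `p ↦ f_λ(q, p)` is maximal at `p = q`. -/
lemma fBA_le_fBA_self (hρ : ∀ x, IsDensity (ρ x)) (hq : IsDist q) (hp : IsDist p)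
    (hqp : ∀ x, p x = 0 → q x = 0) : fBA ρ s lam q p ≤ fBA ρ s lam q q := by
  have h := qRelEnt_sum_smul_le_cRelEnt hρ hq hp hqp
  rw [qRelEnt_sum_smul, cRelEnt] at h
  rw [fBA_eq_sum hρ hq.1 hp.1 fun x => mt (hqp x), fBA_eq_sum hρ hq.1 hq.1 fun _ => id]
  simp only [mul_sub, mul_add, Finset.sum_sub_distrib, Finset.sum_add_distrib] at h ⊢
  linarith

end BlahutArimoto

/-- one-step bound
`0 ≤ F(λ) − f_λ(p^{t+1},p^t) ≤ D(p*‖p^t) − D(p*‖p^{t+1})` with `F(λ) = f_λ(p*,p*)`;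
in particular `D(p*‖p^t)` is non-increasing along the BA iteration. -/
theorem stmt_10 {n m : ℕ} (lam : ℝ) (hlam : 0 ≤ lam)
    (s : Fin n → ℝ) (hs : ∀ x, 0 ≤ s x)
    (ρ : Fin n → Matrix (Fin m) (Fin m) ℂ) (hρ : ∀ x, IsDensity (ρ x))
    (pt : Fin n → ℝ) (hpt : IsDist pt) (hptpos : ∀ x, 0 < pt x)
    (pstar : Fin n → ℝ) (hps : IsDist pstar)
    (hmax : ∀ q : Fin n → ℝ, IsDist q → fBA ρ s lam q q ≤ fBA ρ s lam pstar pstar) :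
    0 ≤ fBA ρ s lam pstar pstar - fBA ρ s lam (baStep ρ s lam pt) pt ∧
    fBA ρ s lam pstar pstar - fBA ρ s lam (baStep ρ s lam pt) pt ≤
      cRelEnt pstar pt - cRelEnt pstar (baStep ρ s lam pt) := by
  have hq := isDist_baStep (ρ := ρ) (s := s) (lam := lam) hpt
  constructor
  · rw [sub_nonneg]
    exact (fBA_le_fBA_self hρ hq hpt fun x hx => absurd hx (hptpos x).ne').trans (hmax _ hq)
  · have hK := qRelEnt_nonneg (posSemidef_sum_smul hρ hps.1) (posSemidef_sum_smul hρ hpt.1)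
      (suppLE_sum_smul_sum_smul hρ hpt.1 fun x _ => (hptpos x).ne')
      (by rw [trace_sum_smul hρ hps.2, trace_sum_smul hρ hpt.2])
    have hZ : ∑ x, pstar x * Real.log (∑ y, rBA ρ s lam pt y) =
        Real.log (∑ y, rBA ρ s lam pt y) := by
      rw [← Finset.sum_mul, hps.2, one_mul]
    rw [qRelEnt_sum_smul] at hK
    rw [fBA_baStep hρ hpt hptpos, fBA_eq_sum hρ hps.1 hps.1 fun _ => id, cRelEnt, cRelEnt]
    simp only [log_baStep hρ hpt (hptpos _)]
    simp only [mul_sub, mul_add, Finset.sum_sub_distrib, Finset.sum_add_distrib] at hK ⊢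
    linarith
end

section
/- For any m×m density matrices ρ, σ with supp(ρ) ⊆ supp(σ), the quantum relative entropy (with natural logarithm) satisfies D(ρ‖σ) ≥ (1/2) Tr[(ρ − σ)²]. -/
open Matrix Finset Filter ComplexOrder

/-- Second-order strengthening of the Bregman inequality for `x log x` on `[0, 1]`. -/
lemma sub_add_sq_div_two_le_mul_log_sub_log {a b : ℝ} (ha : 0 ≤ a) (ha1 : a ≤ 1)
    (hb : 0 < b) (hb1 : b ≤ 1) :
    a - b + (a - b) ^ 2 / 2 ≤ a * (Real.log a - Real.log b) := by
  rcases ha.eq_or_lt with rfl | ha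
  · nlinarith
  have mono : ∀ x y : ℝ, 0 < x → x ≤ y → y ≤ 1 →
      Real.log x - x ≤ Real.log y - y := by
    intro x y hx hxy hy
    have hy0 : 0 < y := hx.trans_le hxy
    have h1 := Real.log_le_sub_one_of_pos (div_pos hx hy0)
    rw [Real.log_div hx.ne' hy0.ne'] at h1
    have h2 : y - x ≤ 1 - x / y := by
      rw [one_sub_div hy0.ne', le_div_iff₀ hy0]
      nlinarith
    linarith
  have hder : ∀ x : ℝ, 0 < x → HasDerivAt
      (fun x => x * Real.log x - x * Real.log b - x - (x - b) ^ 2 / 2)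
      (Real.log x - Real.log b - (x - b)) x := by
    intro x hx
    have h := (((Real.hasDerivAt_mul_log hx.ne').sub
      ((hasDerivAt_id x).mul_const (Real.log b))).sub (hasDerivAt_id x)).sub
      ((((hasDerivAt_id x).sub_const b).pow 2).div_const 2)
    refine h.congr_deriv ?_
    simp only [id]
    ring
  have hcont : ∀ x y : ℝ, 0 < x → ContinuousOn
      (fun x => x * Real.log x - x * Real.log b - x - (x - b) ^ 2 / 2) (Set.Icc x y) :=
    fun x y hx z hz => (hder z (hx.trans_le hz.1)).continuousAt.continuousWithinAt
  rcases lt_trichotomy a b with hab | rfl | hab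
  · obtain ⟨c, hc, h⟩ := exists_hasDerivAt_eq_slope _ _ hab (hcont a b ha)
      fun x hx => hder x (ha.trans hx.1)
    rw [eq_div_iff (sub_pos.2 hab).ne'] at h
    have := mono c b (ha.trans hc.1) hc.2.le hb1
    nlinarith
  · simp
  · obtain ⟨c, hc, h⟩ := exists_hasDerivAt_eq_slope _ _ hab (hcont b a hb)
      fun x hx => hder x (hb.trans hx.1)
    rw [eq_div_iff (sub_pos.2 hab).ne'] at h
    have := mono b c hb hc.1.le (hc.2.le.trans ha1)
    nlinarith

/-- The trace of a product of two diagonalized matrices, in terms of the overlaps of the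
two bases. -/
lemma re_trace_conj_diagonal_mul_conj_diagonal {m : ℕ} (U V : Matrix (Fin m) (Fin m) ℂ)
    (f g : Fin m → ℝ) :
    (trace ((U * diagonal (fun i => (f i : ℂ)) * star U) *
      (V * diagonal (fun i => (g i : ℂ)) * star V))).re =
      ∑ i, ∑ j, f i * g j * Complex.normSq ((star U * V) i j) := by
  have h : trace ((U * diagonal (fun i => (f i : ℂ)) * star U) *
      (V * diagonal (fun i => (g i : ℂ)) * star V)) =
      trace ((diagonal (fun i => (f i : ℂ)) * (star U * V)) *
        (diagonal (fun i => (g i : ℂ)) * star (star U * V))) := by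
    rw [star_mul, star_star]
    simp only [Matrix.mul_assoc]
    rw [trace_mul_comm]
    simp only [Matrix.mul_assoc]
  rw [h]
  generalize star U * V = W
  rw [trace, Complex.re_sum]
  refine sum_congr rfl fun i _ => ?_
  rw [diag_apply, mul_apply, Complex.re_sum]
  refine sum_congr rfl fun j _ => ?_
  rw [diagonal_mul, diagonal_mul, star_apply, Complex.star_def,
    show (f i : ℂ) * W i j * ((g j : ℂ) * (starRingEnd ℂ) (W i j)) =
      (f i : ℂ) * g j * (W i j * (starRingEnd ℂ) (W i j)) by ring, Complex.mul_conj]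
  norm_cast

/-- The trace of a product of two matrices diagonalized in the same basis. -/
lemma re_trace_conj_diagonal_mul_self {m : ℕ} {U : Matrix (Fin m) (Fin m) ℂ}
    (hU : star U * U = 1) (f g : Fin m → ℝ) :
    (trace ((U * diagonal (fun i => (f i : ℂ)) * star U) *
      (U * diagonal (fun i => (g i : ℂ)) * star U))).re = ∑ i, f i * g i := by
  rw [re_trace_conj_diagonal_mul_conj_diagonal, hU]
  refine sum_congr rfl fun i _ => ?_
  rw [sum_eq_single i]
  · simp
  · intro j _ hj
    simp [one_apply_ne hj.symm]
  · simp

lemma sum_normSq_row {m : ℕ} {W : Matrix (Fin m) (Fin m) ℂ} (hW : W * star W = 1)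
    (i : Fin m) : ∑ j, Complex.normSq (W i j) = 1 := by
  have h := congrFun (congrFun hW i) i
  simp only [mul_apply, star_apply, Complex.star_def, Complex.mul_conj, one_apply_eq] at h
  exact_mod_cast h

lemma sum_normSq_col {m : ℕ} {W : Matrix (Fin m) (Fin m) ℂ} (hW : star W * W = 1)
    (j : Fin m) : ∑ i, Complex.normSq (W i j) = 1 := by
  have h := sum_normSq_row (W := star W) (by rwa [star_star]) j
  simpa [star_apply, Complex.normSq_conj] using h

lemma Matrix.IsHermitian.eq_conj_diagonal {m : ℕ} {A : Matrix (Fin m) (Fin m) ℂ}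
    (h : A.IsHermitian) :
    A = (h.eigenvectorUnitary : Matrix (Fin m) (Fin m) ℂ) *
      diagonal (fun i => (h.eigenvalues i : ℂ)) *
      star (h.eigenvectorUnitary : Matrix (Fin m) (Fin m) ℂ) := by
  conv_lhs => rw [h.spectral_theorem]
  rfl

lemma IsDensity.sum_eigenvalues {m : ℕ} {A : Matrix (Fin m) (Fin m) ℂ} (hA : IsDensity A) :
    ∑ i, hA.1.isHermitian.eigenvalues i = 1 := by
  have h := hA.1.isHermitian.trace_eq_sum_eigenvalues
  apply Complex.ofReal_injective
  push_cast
  exact h.symm.trans hA.2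

lemma IsDensity.eigenvalues_le_one {m : ℕ} {A : Matrix (Fin m) (Fin m) ℂ}
    (hA : IsDensity A) (i : Fin m) : hA.1.isHermitian.eigenvalues i ≤ 1 := by
  rw [← hA.sum_eigenvalues]
  exact single_le_sum (f := hA.1.isHermitian.eigenvalues)
    (fun j _ => hA.1.eigenvalues_nonneg j) (mem_univ i)

/-- Under `SuppLE`, eigenvectors of `σ` in its kernel are orthogonal to the eigenvectors of
`ρ` with nonzero eigenvalue. -/
lemma SuppLE.eigenvalue_mul_overlap_eq_zero {m : ℕ} {ρ σ : Matrix (Fin m) (Fin m) ℂ}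
    (h : SuppLE ρ σ) {U V : Matrix (Fin m) (Fin m) ℂ} {a b : Fin m → ℝ}
    (hU : star U * U = 1) (hV : star V * V = 1)
    (hρ : ρ = U * diagonal (fun i => (a i : ℂ)) * star U)
    (hσ : σ = V * diagonal (fun i => (b i : ℂ)) * star V)
    {j : Fin m} (hj : b j = 0) (i : Fin m) : (a i : ℂ) * (star U * V) i j = 0 := by
  have h1 : σ *ᵥ (V *ᵥ Pi.single j 1) = 0 := by
    rw [mulVec_mulVec, hσ, Matrix.mul_assoc, hV, Matrix.mul_one, ← mulVec_mulVec,
      diagonal_mulVec_single]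
    simp [hj]
  have h2 : (star U * ρ * V) *ᵥ Pi.single j 1 = 0 := by
    rw [Matrix.mul_assoc, ← mulVec_mulVec, ← mulVec_mulVec, h _ h1, mulVec_zero]
  rw [hρ, Matrix.mul_assoc U, ← Matrix.mul_assoc (star U) U, hU, Matrix.one_mul,
    Matrix.mul_assoc] at h2
  have h3 := congrFun h2 i
  rwa [mulVec_single_one, Matrix.col_apply, diagonal_mul] at h3

/-- quantum Pinsker-type bound, Theorem 7:
`D(ρ‖σ) ≥ (1/2) Tr[(ρ − σ)²]` for density matrices with `supp ρ ⊆ supp σ`. -/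
theorem stmt_15 {m : ℕ} (ρ σ : Matrix (Fin m) (Fin m) ℂ)
    (hρ : IsDensity ρ) (hσ : IsDensity σ) (hsupp : SuppLE ρ σ) :
    (1 / 2) * (Matrix.trace ((ρ - σ) * (ρ - σ))).re ≤ qRelEnt ρ σ := by
  have hρH := hρ.1.isHermitian
  have hσH := hσ.1.isHermitian
  have ha0 := hρ.1.eigenvalues_nonneg
  have hb0 := hσ.1.eigenvalues_nonneg
  have ha1 := hρ.eigenvalues_le_one
  have hb1 := hσ.eigenvalues_le_one
  have has := hρ.sum_eigenvalues
  have hbs := hσ.sum_eigenvalues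
  have hρe := hρH.eq_conj_diagonal
  have hσe := hσH.eq_conj_diagonal
  have hlρ : mlog ρ = _ := dif_pos hρH
  have hlσ : mlog σ = _ := dif_pos hσH
  have hU : star (hρH.eigenvectorUnitary : Matrix (Fin m) (Fin m) ℂ) *
    hρH.eigenvectorUnitary = 1 := Unitary.coe_star_mul_self _
  have hV : star (hσH.eigenvectorUnitary : Matrix (Fin m) (Fin m) ℂ) *
    hσH.eigenvectorUnitary = 1 := Unitary.coe_star_mul_self _
  have hV' : (hσH.eigenvectorUnitary : Matrix (Fin m) (Fin m) ℂ) *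
    star (hσH.eigenvectorUnitary : Matrix (Fin m) (Fin m) ℂ) = 1 := Unitary.coe_mul_star_self _
  generalize (hρH.eigenvectorUnitary : Matrix (Fin m) (Fin m) ℂ) = U at *
  generalize (hσH.eigenvectorUnitary : Matrix (Fin m) (Fin m) ℂ) = V at *
  generalize hρH.eigenvalues = a at *
  generalize hσH.eigenvalues = b at *
  have hW : (star U * V) * star (star U * V) = 1 := by
    rw [star_mul, star_star, Matrix.mul_assoc, ← Matrix.mul_assoc V, hV', Matrix.one_mul, hU]
  have hker := fun {j} (hj : b j = 0) i =>
    hsupp.eigenvalue_mul_overlap_eq_zero hU hV hρe hσe hj i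
  have hrr : (trace (ρ * ρ)).re = ∑ i, a i * a i := by
    rw [hρe, re_trace_conj_diagonal_mul_self hU]
  have hss : (trace (σ * σ)).re = ∑ j, b j * b j := by
    rw [hσe, re_trace_conj_diagonal_mul_self hV]
  have hrs : (trace (ρ * σ)).re =
      ∑ i, ∑ j, a i * b j * Complex.normSq ((star U * V) i j) := by
    rw [hρe, hσe, re_trace_conj_diagonal_mul_conj_diagonal]
  have hrl : (trace (ρ * mlog ρ)).re = ∑ i, a i * Real.log (a i) := by
    rw [hlρ, hρe, re_trace_conj_diagonal_mul_self hU]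
  have hsl : (trace (ρ * mlog σ)).re =
      ∑ i, ∑ j, a i * Real.log (b j) * Complex.normSq ((star U * V) i j) := by
    rw [hlσ, hρe, re_trace_conj_diagonal_mul_conj_diagonal]
  have hrow := sum_normSq_row hW
  have hcol := sum_normSq_col (mul_eq_one_comm.1 hW)
  have hnn := fun i j => Complex.normSq_nonneg ((star U * V) i j)
  have hkerN : ∀ i j, b j = 0 → a i = 0 ∨ Complex.normSq ((star U * V) i j) = 0 := by
    intro i j hj
    simpa using mul_eq_zero.1 (hker hj i)
  generalize star U * V = W at *
  have hterm : ∀ i j, (a i - b j + (a i - b j) ^ 2 / 2) * Complex.normSq (W i j) ≤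
      a i * (Real.log (a i) - Real.log (b j)) * Complex.normSq (W i j) := by
    intro i j
    rcases (hb0 j).eq_or_lt with hj | hj
    · rcases hkerN i j hj.symm with h | h
      · simp [h, ← hj]
      · simp [h]
    · exact mul_le_mul_of_nonneg_right
        (sub_add_sq_div_two_le_mul_log_sub_log (ha0 i) (ha1 i) hj (hb1 j)) (hnn i j)
  have hsum := sum_le_sum fun i (_ : i ∈ univ) => sum_le_sum fun j (_ : j ∈ univ) =>
    hterm i j
  have hrowsum : ∀ f : Fin m → ℝ,
      ∑ i, ∑ j, f i * Complex.normSq (W i j) = ∑ i, f i := by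
    intro f
    simp only [← mul_sum, hrow, mul_one]
  have hcolsum : ∀ f : Fin m → ℝ,
      ∑ i, ∑ j, f j * Complex.normSq (W i j) = ∑ j, f j := by
    intro f
    rw [sum_comm]
    simp only [← mul_sum, hcol, mul_one]
  have hL : ∑ i, ∑ j, (a i - b j + (a i - b j) ^ 2 / 2) * Complex.normSq (W i j) =
      (1 / 2) * ((trace (ρ * ρ)).re - 2 * (trace (ρ * σ)).re + (trace (σ * σ)).re) := by
    have h : ∀ i j, (a i - b j + (a i - b j) ^ 2 / 2) * Complex.normSq (W i j) =
        a i * Complex.normSq (W i j) - b j * Complex.normSq (W i j) +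
        (1 / 2) * (a i * a i * Complex.normSq (W i j)) -
        a i * b j * Complex.normSq (W i j) +
        (1 / 2) * (b j * b j * Complex.normSq (W i j)) := fun i j => by ring
    simp only [h, sum_add_distrib, sum_sub_distrib, ← mul_sum _ _ (1 / 2 : ℝ)]
    rw [hrr, hss, hrs, hrowsum, hcolsum, hrowsum (fun i => a i * a i),
      hcolsum (fun j => b j * b j), has, hbs]
    ring
  have hR : ∑ i, ∑ j, a i * (Real.log (a i) - Real.log (b j)) * Complex.normSq (W i j) =
      qRelEnt ρ σ := by
    rw [qRelEnt, Matrix.mul_sub, trace_sub, Complex.sub_re, hrl, hsl,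
      ← hrowsum (fun i => a i * Real.log (a i)), ← sum_sub_distrib]
    refine sum_congr rfl fun i _ => ?_
    rw [← sum_sub_distrib]
    exact sum_congr rfl fun j _ => by ring
  rw [hL, hR] at hsum
  refine le_of_eq_of_le ?_ hsum
  rw [Matrix.sub_mul, Matrix.mul_sub, Matrix.mul_sub, trace_sub, trace_sub, trace_sub,
    trace_mul_comm σ ρ]
  simp only [Complex.sub_re]
  ring
end
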